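/- Let N ≥ 3, θ ∈ (0, π/4], and α = 2cos(2θ)/√(1+sin²(2θ)). Let H_1,…,H_N be finite-dimensional complex Hilbert spaces, |ψ⟩ a unit vector in H_1⊗⋯⊗H_N, and for each i ∈ {1,…,N} let A_{0,i}, A_{1,i} be self-adjoint unitary operators on H_i, acting on the i-th tensor factor. Assume: (i) ⟨ψ|P^0_{A_{0,i}}|ψ⟩ = cos²θ and ⟨ψ|P^0_{A_{0,i}} P^0_{A_{0,j}}|ψ⟩ = cos²θ for all i,j ∈ {1,…,N−1}; (ii) ⟨ψ|∏_{i=1}^{N−2} P^{a_i}_{A_{1,i}}|ψ⟩ = 2^{−(N−2)} for every (a_1,…,a_{N−2}) ∈ {0,1}^{N−2}; (iii) ⟨ψ|(∏_{i=1}^{N−2} P^{a_i}_{A_{1,i}})·(α A_{0,N−1} + A_{0,N−1}A_{0,N} + A_{0,N−1}A_{1,N} + (−1)^{a_1+⋯+a_{N−2}}(A_{1,N−1}A_{0,N} − A_{1,N−1}A_{1,N}))|ψ⟩ = √(8+2α²)·2^{−(N−2)} for every (a_1,…,a_{N−2}) ∈ {0,1}^{N−2}. Then there exist linear isometries V_i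 : H_i → H_i ⊗ ℂ² (i = 1,…,N) and a unit vector |junk⟩ ∈ H_1⊗⋯⊗H_N such that, under the canonical reordering of tensor factors, (V_1⊗⋯⊗V_N)|ψ⟩ = |junk⟩ ⊗ (cosθ |0⟩^{⊗N} + sinθ |1⟩^{⊗N}). -/

import Mathlib

open scoped BigOperators
open Matrix

noncomputable section

/-- The projector `P^a_D = (I + (-1)^a D)/2`. -/
def projP {n : Type*} [Fintype n] [DecidableEq n] (a : Fin 2) (D : Matrix n n ℂ) :
    Matrix n n ℂ :=
  (2 : ℂ)⁻¹ • (1 + ((-1 : ℂ) ^ a.val) • D)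

/-- The operator on `H_1 ⊗ ⋯ ⊗ H_N` acting as `M` on the `i`-th tensor factor and as the
identity elsewhere. -/
def siteOp {N : ℕ} {d : Fin N → ℕ} (i : Fin N) (M : Matrix (Fin (d i)) (Fin (d i)) ℂ) :
    Matrix ((j : Fin N) → Fin (d j)) ((j : Fin N) → Fin (d j)) ℂ :=
  fun x y => M (x i) (y i) * ∏ j ∈ Finset.univ.erase i, (if x j = y j then (1 : ℂ) else 0)

/-- The operator on `H_1 ⊗ ⋯ ⊗ H_N` acting as `F i` on the tensor factors `i ∈ S` and as
the identity elsewhere; this is the (commuting) product of the single-site operators. -/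
def multiOp {N : ℕ} {d : Fin N → ℕ} (S : Finset (Fin N))
    (F : (i : Fin N) → Matrix (Fin (d i)) (Fin (d i)) ℂ) :
    Matrix ((j : Fin N) → Fin (d j)) ((j : Fin N) → Fin (d j)) ℂ :=
  fun x y => (∏ i ∈ S, F i (x i) (y i)) * ∏ j ∈ Sᶜ, (if x j = y j then (1 : ℂ) else 0)

/-- The tilted CHSH Bell operator on the last two sites (1-indexed sites `N-1` and `N`),
with sign `ε = (-1)^{a_1+⋯+a_{N-2}}` on the `A_1`-terms:
`α A_{0,N-1}⊗I + A_{0,N-1}A_{0,N} + A_{0,N-1}A_{1,N} + ε(A_{1,N-1}A_{0,N} - A_{1,N-1}A_{1,N})`. -/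
def tiltedW {N : ℕ} {d : Fin N → ℕ} (hN : 2 ≤ N) (α : ℝ)
    (A : Fin 2 → (i : Fin N) → Matrix (Fin (d i)) (Fin (d i)) ℂ) (ε : ℂ) :
    Matrix ((j : Fin N) → Fin (d j)) ((j : Fin N) → Fin (d j)) ℂ :=
  (α : ℂ) • siteOp (⟨N - 2, by omega⟩ : Fin N) (A 0 ⟨N - 2, by omega⟩) +
  siteOp (⟨N - 2, by omega⟩ : Fin N) (A 0 ⟨N - 2, by omega⟩) *
    siteOp (⟨N - 1, by omega⟩ : Fin N) (A 0 ⟨N - 1, by omega⟩) +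
  siteOp (⟨N - 2, by omega⟩ : Fin N) (A 0 ⟨N - 2, by omega⟩) *
    siteOp (⟨N - 1, by omega⟩ : Fin N) (A 1 ⟨N - 1, by omega⟩) +
  ε • (siteOp (⟨N - 2, by omega⟩ : Fin N) (A 1 ⟨N - 2, by omega⟩) *
      siteOp (⟨N - 1, by omega⟩ : Fin N) (A 0 ⟨N - 1, by omega⟩) -
    siteOp (⟨N - 2, by omega⟩ : Fin N) (A 1 ⟨N - 2, by omega⟩) *
      siteOp (⟨N - 1, by omega⟩ : Fin N) (A 1 ⟨N - 1, by omega⟩))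

/-- The tilted GHZ state with digit string `k`. -/
def ghzVec (N : ℕ) (θ : ℝ) (k : Fin N → Fin 2) : (Fin N → Fin 2) → ℂ :=
  fun x =>
    (if x = k then ((-1 : ℂ) ^ (∑ i, (k i).val)) * (Real.cos θ : ℂ) else 0) +
    (if x = (fun i => 1 - k i) then (Real.sin θ : ℂ) else 0)

/-- `(V_1 ⊗ ⋯ ⊗ V_N)` applied to a vector of `H_1 ⊗ ⋯ ⊗ H_N`, where
`V_i : H_i → H_i ⊗ ℂ²` and the output tensor factors are canonically reordered so that
the `H_i` factors come first and the `ℂ²` factors second. -/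
def tensorApply {N : ℕ} {d : Fin N → ℕ}
    (V : (i : Fin N) → Matrix (Fin (d i) × Fin 2) (Fin (d i)) ℂ)
    (ψ : ((i : Fin N) → Fin (d i)) → ℂ) :
    (((i : Fin N) → Fin (d i)) × (Fin N → Fin 2)) → ℂ :=
  fun p => ∑ y, (∏ i, V i (p.1 i, p.2 i) (y i)) * ψ y


theorem core1 {V : Type*} [AddCommGroup V] [Module ℂ V] (a x p m : V →ₗ[ℂ] V)
    (haa : ∀ v, a (a v) = v) (hxx : ∀ v, x (x v) = v)
    (hpa : ∀ v, p (a v) = a (p v)) (hpx : ∀ v, p (x v) = x (p v))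
    (hma : ∀ v, m (a v) = a (m v)) (hmx : ∀ v, m (x v) = x (m v))
    (hmp : ∀ v, m (p v) = - p (m v)) (hsq : ∀ v, m (m v) = (4:ℂ) • v - p (p v))
    (c k ε : ℂ) (hε : ε * ε = 1) (hk : k ^ 2 * (2 - c ^ 2) = 1) (hc : c ^ 2 ≠ 1) (φ : V)
    (E1 : (2 * c * k) • a φ + a (p φ) + ε • x (m φ) = (4 * k) • φ)
    (E2 : ε • ((2 * c * k) • x φ - x (p φ)) - a (m φ) = 0) :
    p φ = (2 * k) • a φ ∧ m φ = ε • ((2 * k) • x (φ - c • a φ)) := by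
  have hk0 : k ≠ 0 := by rintro rfl; simp at hk
  have e1 := congrArg a E1
  have e2 := congrArg m (congrArg a E2)
  have e3 := congrArg p e1
  simp only [map_add, map_sub, map_smul, map_zero, haa, hpa, hpx, hma, hmx, hmp, hsq, map_neg] at e1 e2 e3
  have F : (4 + (2*c*k)^2) • φ + (2 * (2*c*k)) • p φ - ((2*c*k)*(4*k)) • a φ - (4*k) • a (p φ) = 0 := by
    linear_combination (norm := module) (-1 : ℂ) • e2 + (2*c*k) • e1 + e3
  have F2 := congrArg a F
  simp only [map_add, map_sub, map_smul, map_zero, haa] at F2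
  have hp : p φ = (2 * k) • a φ := by
    have : (16 * k^2 - 4 * (2*c*k)^2 : ℂ) ≠ 0 := by
      have : (16 * k^2 - 4 * (2*c*k)^2 : ℂ) = 16 * k^2 * (1 - c^2) := by ring
      rw [this]
      exact mul_ne_zero (mul_ne_zero (by norm_num) (pow_ne_zero 2 hk0)) (sub_ne_zero.2 hc.symm)
    apply smul_right_injective V this
    have h8 : (16 * k^2 : ℂ) = 8 + 2 * (2*c*k)^2 := by linear_combination 8 * hk
    simp only
    linear_combination (norm := module) (-(4*k)) • F2 - (2*(2*c*k)) • F + (h8 * (-2*k)) • a φ + (h8 * (-2 * c*k)) • φ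
  refine ⟨hp, ?_⟩
  have e4 := congrArg x E1
  have e5 := congrArg (fun v => x (a v)) hp
  simp only [map_add, map_sub, map_smul, haa, hxx] at e4 e5 ⊢
  have : m φ = ε • ε • m φ := by rw [smul_smul, hε, one_smul]
  rw [this]
  linear_combination (norm := module) ε • e4 - ε • e5

theorem core2 {V : Type*} [AddCommGroup V] [Module ℂ V] (a x p m : V →ₗ[ℂ] V)
    (haa : ∀ v, a (a v) = v) (hxx : ∀ v, x (x v) = v)
    (hpa : ∀ v, p (a v) = a (p v)) (hpx : ∀ v, p (x v) = x (p v))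
    (hma : ∀ v, m (a v) = a (m v)) 
    (hmp : ∀ v, m (p v) = - p (m v)) (hsq : ∀ v, m (m v) = (4:ℂ) • v - p (p v))
    (c s k : ℂ) (hk : k ^ 2 * (2 - c ^ 2) = 1) (hc : c ^ 2 ≠ 1) (hcs : s ^ 2 + c ^ 2 = 1)
    (φ : V)
    (hp : p φ = (2 * k) • a φ) (hm : m φ = (2 * k) • x (φ - c • a φ)) :
    (2*k)⁻¹ • p φ = a φ ∧ (2*k)⁻¹ • p ((2*k)⁻¹ • p φ) = φ ∧ 
    (2*k*s)⁻¹ • m φ = s⁻¹ • x (φ - c • a φ) ∧ (2*k*s)⁻¹ • m ((2*k*s)⁻¹ • m φ) = φ ∧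
    x ((2⁻¹ : ℂ) • ((2*k*s)⁻¹ • m φ - a ((2*k*s)⁻¹ • m φ))) = ((1 - c) / s) • ((2⁻¹ : ℂ) • (φ + a φ)) := by
  have hk0 : k ≠ 0 := by rintro rfl; simp at hk
  have hs0 : s ≠ 0 := by rintro rfl; apply hc; linear_combination hcs
  have hpp : p (p φ) = (4 * k^2) • φ := by
    rw [hp, map_smul, hpa, hp, map_smul, haa]; module
  have hm' : (2*k*s)⁻¹ • m φ = s⁻¹ • x (φ - c • a φ) := by
    rw [hm, smul_smul]; congr 1; field_simp
  have hu : a (x φ) = - x (a φ) := by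
    have e1 := hmp φ
    rw [hp, hm] at e1
    simp only [map_sub, map_smul, hpa, hpx, hma, hp, haa, hm] at e1
    have e3 : a (x φ) + x (a φ) = c • (x φ + a (x (a φ))) := by
      have : (4*k^2 : ℂ) ≠ 0 := mul_ne_zero (by norm_num) (pow_ne_zero 2 hk0)
      apply smul_right_injective V this
      simp only
      linear_combination (norm := module) e1
    have e4 := congrArg a e3
    simp only [map_add, map_smul, haa] at e4
    have e5 : a (x φ) + x (a φ) = 0 := by
      apply smul_right_injective V (sub_ne_zero.2 hc.symm)
      simp only [smul_zero]
      linear_combination (norm := module) e3 + c • e4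
    exact eq_neg_of_add_eq_zero_left e5
  have hu2 : a (x (a φ)) = - x φ := by
    have := congrArg a hu
    simp only [haa, map_neg] at this
    rw [this, neg_neg]
  refine ⟨?_, ?_, hm', ?_, ?_⟩
  · rw [hp, smul_smul, inv_mul_cancel₀ (mul_ne_zero (by norm_num) hk0), one_smul]
  · rw [map_smul, hpp, smul_smul, smul_smul]
    convert one_smul ℂ φ
    field_simp; norm_num
  · rw [map_smul, hsq, hpp]
    simp only [← sub_smul, smul_smul]
    convert one_smul ℂ φ
    field_simp
    linear_combination 4 * k^2 * hcs * (-1) + 4 * hk * (-1)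
  · rw [hm']
    simp only [map_sub, map_smul, hu, hu2, hxx, map_neg]
    module

theorem vecZ {n : Type*} [Fintype n] (v : n → ℂ) (h : star v ⬝ᵥ v = 0) : v = 0 := by
  open scoped ComplexOrder in
  exact dotProduct_star_self_eq_zero.1 h

theorem sos {n : Type*} [Fintype n] [DecidableEq n] (W T : Matrix n n ℂ) (hW : W.IsHermitian)
    (hT : T.IsHermitian) (β : ℝ) (h : W * W + T * T = ((β : ℂ) ^ 2) • 1) (φ : n → ℂ)
    (hφ : star φ ⬝ᵥ W *ᵥ φ = β * (star φ ⬝ᵥ φ)) : W *ᵥ φ = (β : ℂ) • φ ∧ T *ᵥ φ = 0 := by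
  have adj : ∀ (M : Matrix n n ℂ), M.IsHermitian → ∀ u v : n → ℂ, star (M *ᵥ u) ⬝ᵥ v = star u ⬝ᵥ M *ᵥ v := by
    intro M hM u v
    rw [star_mulVec, hM.eq, dotProduct_mulVec]
  have h1 : star (W *ᵥ φ - (β : ℂ) • φ) ⬝ᵥ (W *ᵥ φ - (β : ℂ) • φ) + star (T *ᵥ φ) ⬝ᵥ (T *ᵥ φ) = 0 := by
    have e : star φ ⬝ᵥ (W *ᵥ W *ᵥ φ) + star φ ⬝ᵥ (T *ᵥ T *ᵥ φ) = β^2 * (star φ ⬝ᵥ φ) := by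
      rw [← dotProduct_add, mulVec_mulVec, mulVec_mulVec, ← add_mulVec, h, smul_mulVec, one_mulVec, dotProduct_smul, smul_eq_mul]
    rw [star_sub, star_smul, sub_dotProduct, dotProduct_sub, dotProduct_sub, smul_dotProduct, smul_dotProduct, dotProduct_smul, dotProduct_smul, adj W hW, adj W hW, adj T hT]
    simp only [smul_eq_mul, hφ, Complex.star_def, Complex.conj_ofReal]
    linear_combination e
  open scoped ComplexOrder in
  have := (add_eq_zero_iff_of_nonneg (dotProduct_star_self_nonneg _) (dotProduct_star_self_nonneg _)).1 h1
  exact ⟨sub_eq_zero.1 (vecZ _ this.1), vecZ _ this.2⟩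

theorem signLemma {n : Type*} [Fintype n] [DecidableEq n] (C : Matrix n n ℂ) (hC : C.IsHermitian) :
    ∃ U G : Matrix n n ℂ, U.IsHermitian ∧ U * U = 1 ∧ U = C + G * (C * C - 1) := by
  have hC' : IsSelfAdjoint C := hC
  let f : ℝ → ℝ := fun x => if x = -1 then -1 else 1
  let g : ℝ → ℝ := fun x => if x^2 = 1 then 0 else (f x - x) / (x * x - 1)
  have hfin : (spectrum ℝ C).Finite := Matrix.finite_real_spectrum
  have hf : ∀ h : ℝ → ℝ, ContinuousOn h (spectrum ℝ C) := fun h => hfin.continuousOn h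
  refine ⟨cfc f C, cfc g C, cfc_predicate f C, ?_, ?_⟩
  · rw [← cfc_mul f f C (hf _) (hf _)]
    have : (fun x => f x * f x) = fun _ => 1 := by funext x; simp only [f]; split_ifs <;> norm_num
    rw [this, cfc_const_one ℝ C]
  · have e1 : C * C - 1 = cfc (fun x : ℝ => x * x - 1) C := by
      rw [cfc_sub _ _ C (hf _) (hf _), cfc_mul _ _ C (hf _) (hf _), cfc_const_one ℝ C, cfc_id' ℝ C]
    rw [e1, ← cfc_mul _ _ C (hf _) (hf _)]
    conv_rhs => enter [1]; rw [← cfc_id' ℝ C]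
    rw [← cfc_add C _ _ (hf _) (hf _)]
    congr 1
    funext x
    simp only [g]
    split_ifs with h
    · rcases (sq_eq_sq_iff_eq_or_eq_neg.1 (h.trans (one_pow 2).symm)) with h | h <;> (simp [f, h]; try norm_num)
    · have : x * x - 1 ≠ 0 := by intro h'; apply h; linarith
      field_simp; ring

/-- Tensor product of a family of matrices. -/
def tens {N : ℕ} {d : Fin N → ℕ} (F : (i : Fin N) → Matrix (Fin (d i)) (Fin (d i)) ℂ) :
    Matrix ((j : Fin N) → Fin (d j)) ((j : Fin N) → Fin (d j)) ℂ :=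
  fun x y => ∏ i, F i (x i) (y i)

section tens
variable {N : ℕ} {d : Fin N → ℕ}

theorem tens_mul (F G : (i : Fin N) → Matrix (Fin (d i)) (Fin (d i)) ℂ) :
    tens (F * G) = tens F * tens G := by
  ext x y
  simp only [tens, Pi.mul_apply, Matrix.mul_apply, ← Finset.prod_mul_distrib]
  rw [Finset.prod_univ_sum, Fintype.piFinset_univ]

theorem tens_one : tens (1 : (i : Fin N) → Matrix (Fin (d i)) (Fin (d i)) ℂ) = 1 := by
  ext x y
  simp only [tens, Pi.one_apply, Matrix.one_apply, Finset.prod_ite_zero, Finset.prod_const_one, Finset.mem_univ, true_imp_iff]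
  simp only [funext_iff]

theorem tens_herm (F : (i : Fin N) → Matrix (Fin (d i)) (Fin (d i)) ℂ)
    (h : ∀ i, (F i).IsHermitian) : (tens F).IsHermitian := by
  ext x y
  simp only [tens, conjTranspose_apply, star_prod]
  exact Finset.prod_congr rfl fun i _ => (h i).apply _ _

theorem tens_comm {F G : (i : Fin N) → Matrix (Fin (d i)) (Fin (d i)) ℂ} (h : Commute F G) :
    Commute (tens F) (tens G) := by
  unfold Commute SemiconjBy
  rw [← tens_mul, ← tens_mul, h.eq]

theorem siteOp_eq (i : Fin N) (M : Matrix (Fin (d i)) (Fin (d i)) ℂ) :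
    siteOp i M = tens (Pi.mulSingle i M) := by
  ext x y
  simp only [siteOp, tens]
  rw [← Finset.mul_prod_erase _ _ (Finset.mem_univ i), Pi.mulSingle_eq_same]
  congr 1
  refine Finset.prod_congr rfl fun j hj => ?_
  rw [Pi.mulSingle_eq_of_ne (Finset.ne_of_mem_erase hj), Matrix.one_apply]

theorem multiOp_eq (S : Finset (Fin N)) (F : (i : Fin N) → Matrix (Fin (d i)) (Fin (d i)) ℂ) :
    multiOp S F = tens (S.piecewise F 1) := by
  ext x y
  simp only [multiOp, tens]
  rw [← Finset.prod_mul_prod_compl S]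
  congr 1
  · refine Finset.prod_congr rfl fun j hj => ?_
    rw [Finset.piecewise_eq_of_mem _ _ _ hj]
  · refine Finset.prod_congr rfl fun j hj => ?_
    rw [Finset.piecewise_eq_of_notMem _ _ _ (Finset.mem_compl.1 hj), Pi.one_apply, Matrix.one_apply]

theorem siteOp_mul (i : Fin N) (M M' : Matrix (Fin (d i)) (Fin (d i)) ℂ) :
    siteOp i (M * M') = siteOp i M * siteOp i M' := by
  rw [siteOp_eq, siteOp_eq, siteOp_eq, ← tens_mul, Pi.mulSingle_mul]

theorem siteOp_one (i : Fin N) : siteOp i (1 : Matrix (Fin (d i)) (Fin (d i)) ℂ) = 1 := by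
  rw [siteOp_eq, Pi.mulSingle_one, tens_one]

theorem siteOp_add (i : Fin N) (M M' : Matrix (Fin (d i)) (Fin (d i)) ℂ) :
    siteOp i (M + M') = siteOp i M + siteOp i M' := by
  ext x y; simp [siteOp, add_mul]

theorem siteOp_sub (i : Fin N) (M M' : Matrix (Fin (d i)) (Fin (d i)) ℂ) :
    siteOp i (M - M') = siteOp i M - siteOp i M' := by
  ext x y; simp [siteOp, sub_mul]

theorem siteOp_smul (i : Fin N) (c : ℂ) (M : Matrix (Fin (d i)) (Fin (d i)) ℂ) :
    siteOp i (c • M) = c • siteOp i M := by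
  ext x y; simp [siteOp, mul_assoc]

theorem siteOp_herm (i : Fin N) (M : Matrix (Fin (d i)) (Fin (d i)) ℂ) (h : M.IsHermitian) :
    (siteOp i M).IsHermitian := by
  rw [siteOp_eq]
  apply tens_herm
  intro j
  by_cases hj : j = i
  · subst hj; simpa using h
  · rw [Pi.mulSingle_eq_of_ne hj]; exact isHermitian_one

theorem siteOp_comm {i j : Fin N} (hij : i ≠ j) (M : Matrix (Fin (d i)) (Fin (d i)) ℂ)
    (M' : Matrix (Fin (d j)) (Fin (d j)) ℂ) : Commute (siteOp i M) (siteOp j M') := by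
  rw [siteOp_eq, siteOp_eq]
  exact tens_comm (Pi.mulSingle_commute hij _ _)

theorem multiOp_siteOp_comm {S : Finset (Fin N)} {j : Fin N} (hj : j ∉ S)
    (F : (i : Fin N) → Matrix (Fin (d i)) (Fin (d i)) ℂ)
    (M' : Matrix (Fin (d j)) (Fin (d j)) ℂ) : Commute (multiOp S F) (siteOp j M') := by
  rw [siteOp_eq, multiOp_eq]
  apply tens_comm
  rw [Pi.commute_iff]
  intro i
  by_cases h : i = j
  · subst h
    rw [Finset.piecewise_eq_of_notMem _ _ _ hj]
    exact Commute.one_left _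
  · rw [Pi.mulSingle_eq_of_ne h]; exact Commute.one_right _

theorem multiOp_mul (S : Finset (Fin N)) (F G : (i : Fin N) → Matrix (Fin (d i)) (Fin (d i)) ℂ) :
    multiOp S F * multiOp S G = multiOp S (F * G) := by
  rw [multiOp_eq, multiOp_eq, multiOp_eq, ← tens_mul]
  congr 1
  funext i
  by_cases h : i ∈ S <;> simp [h]

theorem multiOp_herm (S : Finset (Fin N)) (F : (i : Fin N) → Matrix (Fin (d i)) (Fin (d i)) ℂ)
    (h : ∀ i, (F i).IsHermitian) : (multiOp S F).IsHermitian := by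
  rw [multiOp_eq]
  apply tens_herm
  intro i
  by_cases hi : i ∈ S
  · simpa [hi] using h i
  · simp [hi]

theorem multiOp_smul (S : Finset (Fin N)) (c : Fin N → ℂ)
    (F : (i : Fin N) → Matrix (Fin (d i)) (Fin (d i)) ℂ) :
    multiOp S (fun i => c i • F i) = (∏ i ∈ S, c i) • multiOp S F := by
  ext x y
  simp [multiOp, Finset.prod_mul_distrib, mul_assoc]

theorem multiOp_one (S : Finset (Fin N)) :
    multiOp S (1 : (i : Fin N) → Matrix (Fin (d i)) (Fin (d i)) ℂ) = 1 := by
  rw [multiOp_eq, Finset.piecewise_same, tens_one]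

theorem multiOp_sum (S : Finset (Fin N))
    (F : Fin 2 → (i : Fin N) → Matrix (Fin (d i)) (Fin (d i)) ℂ) (hF : ∀ i, F 0 i + F 1 i = 1) :
    ∃ C : ℂ, C ≠ 0 ∧ ∑ a : Fin N → Fin 2, multiOp S (fun i => F (a i) i) = C • 1 := by
  refine ⟨∏ i, (if i ∈ S then (1:ℂ) else 2), ?_, ?_⟩
  · refine Finset.prod_ne_zero_iff.2 fun i _ => ?_
    split_ifs <;> norm_num
  · ext x y
    rw [Matrix.sum_apply]
    have e : ∀ a : Fin N → Fin 2, multiOp S (fun i => F (a i) i) x y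
        = ∏ i, (if i ∈ S then F (a i) i (x i) (y i) else (1 : Matrix _ _ ℂ) (x i) (y i)) := by
      intro a
      rw [multiOp_eq]
      refine Finset.prod_congr rfl fun i _ => ?_
      by_cases hi : i ∈ S <;> simp [hi]
    simp only [e]
    have := (Finset.prod_univ_sum (fun _ : Fin N => (Finset.univ : Finset (Fin 2)))
      (fun i b => (if i ∈ S then F b i (x i) (y i) else (1 : Matrix _ _ ℂ) (x i) (y i))))
    rw [Fintype.piFinset_univ] at this
    rw [← this, Matrix.smul_apply, ← tens_one]
    simp only [tens, smul_eq_mul, ← Finset.prod_mul_distrib]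
    refine Finset.prod_congr rfl fun i _ => ?_
    by_cases hi : i ∈ S
    · simp [hi, ← hF i]
    · simp [hi]

theorem tens_split (F : (i : Fin N) → Matrix (Fin (d i)) (Fin (d i)) ℂ) (i : Fin N) :
    tens F = tens (Function.update F i 1) * siteOp i (F i) := by
  rw [siteOp_eq, ← tens_mul]
  congr 1
  funext j
  by_cases h : j = i
  · subst h; simp
  · simp [h]

theorem tens_const (P : (i : Fin N) → Matrix (Fin (d i)) (Fin (d i)) ℂ)
    (hP : ∀ i, P i * P i = P i) (i0 : Fin N) (ψ p : ((i : Fin N) → Fin (d i)) → ℂ)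
    (h : ∀ i, siteOp i (P i) *ᵥ ψ = p) : tens P *ᵥ ψ = p := by
  have h1 : ∀ i, siteOp i (P i) *ᵥ p = p := by
    intro i
    conv_lhs => rw [← h i]
    rw [mulVec_mulVec, ← siteOp_mul, hP, h]
  have h2 : ∀ S : Finset (Fin N), multiOp S P *ᵥ p = p := by
    intro S
    induction S using Finset.induction_on with
    | empty => 
      rw [multiOp_eq, Finset.piecewise_empty, tens_one, one_mulVec]
    | insert i S hi ih =>
      have : multiOp (insert i S) P = siteOp i (P i) * multiOp S P := by
        rw [multiOp_eq, multiOp_eq, siteOp_eq, ← tens_mul]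
        congr 1
        funext j
        by_cases hj : j = i
        · subst hj; simp [hi]
        · by_cases hS : j ∈ S <;> simp [hj, hS]
      rw [this, ← mulVec_mulVec, ih, h1]
  have h3 : tens P = tens P * siteOp i0 (P i0) := by
    conv_lhs => rw [tens_split P i0]
    conv_rhs => rw [tens_split P i0]
    rw [mul_assoc, ← siteOp_mul, hP]
  have h4 : tens P = multiOp Finset.univ P := by
    rw [multiOp_eq, Finset.piecewise_univ]
  rw [h3, ← mulVec_mulVec, h i0, h4, h2]

theorem tens_mixed (P : (i : Fin N) → Matrix (Fin (d i)) (Fin (d i)) ℂ) (i j : Fin N) (hij : i ≠ j)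
    (ψ : ((i : Fin N) → Fin (d i)) → ℂ) (h : siteOp j (P j) *ᵥ siteOp i (P i) *ᵥ ψ = 0) :
    tens P *ᵥ ψ = 0 := by
  rw [tens_split P i, tens_split _ j, Function.update_of_ne hij.symm, ← mulVec_mulVec, ← mulVec_mulVec, h,
    mulVec_zero]

end tens

section proj
variable {n : Type*} [Fintype n] [DecidableEq n]

theorem projP_herm (a : Fin 2) (D : Matrix n n ℂ) (h : D.IsHermitian) : (projP a D).IsHermitian := by
  unfold projP Matrix.IsHermitian
  rw [conjTranspose_smul, conjTranspose_add, conjTranspose_smul, h.eq, conjTranspose_one]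
  simp

theorem projP_idem (a : Fin 2) (D : Matrix n n ℂ) (h : D * D = 1) : projP a D * projP a D = projP a D := by
  fin_cases a <;> simp [projP, mul_add, add_mul, h] <;> module

theorem projP_mul (a : Fin 2) (D : Matrix n n ℂ) (h : D * D = 1) :
    D * projP a D = ((-1 : ℂ) ^ a.val) • projP a D := by
  fin_cases a <;> simp [projP, mul_add, h] <;> module

theorem projP_sum (D : Matrix n n ℂ) : projP 0 D + projP 1 D = 1 := by
  simp [projP]; module

theorem projP_orth (D : Matrix n n ℂ) (h : D * D = 1) : projP 0 D * projP 1 D = 0 := by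
  simp [projP, mul_add, add_mul, h]; abel

theorem projP_orth' (D : Matrix n n ℂ) (h : D * D = 1) : projP 1 D * projP 0 D = 0 := by
  simp [projP, mul_add, add_mul, h]

theorem adjH (M : Matrix n n ℂ) (hM : M.IsHermitian) (u v : n → ℂ) :
    star (M *ᵥ u) ⬝ᵥ v = star u ⬝ᵥ M *ᵥ v := by
  rw [star_mulVec, hM.eq, dotProduct_mulVec]

theorem proj_eq (P Q : Matrix n n ℂ) (hP : P.IsHermitian) (hQ : Q.IsHermitian)
    (hPP : P * P = P) (hQQ : Q * Q = Q) (ψ : n → ℂ) (q : ℂ)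
    (h1 : star ψ ⬝ᵥ P *ᵥ ψ = q) (h2 : star ψ ⬝ᵥ Q *ᵥ ψ = q)
    (h3 : star ψ ⬝ᵥ (P * Q) *ᵥ ψ = q) (h4 : star ψ ⬝ᵥ (Q * P) *ᵥ ψ = q) : P *ᵥ ψ = Q *ᵥ ψ := by
  apply sub_eq_zero.1
  apply vecZ
  rw [star_sub, sub_dotProduct, dotProduct_sub, dotProduct_sub, adjH P hP, adjH P hP, adjH Q hQ, adjH Q hQ]
  simp only [mulVec_mulVec, hPP, hQQ, h1, h2, h3, h4]
  ring

theorem sosid {V : Type*} [AddCommGroup V] [Module ℂ V] (a x b0 b1 : V →ₗ[ℂ] V)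
    (haa : ∀ v, a (a v) = v) (hxx : ∀ v, x (x v) = v)
    (h00 : ∀ v, b0 (b0 v) = v) (h11 : ∀ v, b1 (b1 v) = v)
    (h0a : ∀ v, b0 (a v) = a (b0 v)) (h0x : ∀ v, b0 (x v) = x (b0 v))
    (h1a : ∀ v, b1 (a v) = a (b1 v)) (h1x : ∀ v, b1 (x v) = x (b1 v))
    (α β ε : ℂ) (hε : ε = 1 ∨ ε = -1) (hβ : β ^ 2 = 8 + 2 * α ^ 2) (W T : V →ₗ[ℂ] V)
    (hW : W = α • a + a * b0 + a * b1 + ε • (x * b0 - x * b1))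
    (hT : T = ε • (α • x - x * b0 - x * b1) - (a * b0 - a * b1)) (v : V) :
    W (W v) + T (T v) = (β ^ 2) • v := by
  rcases hε with rfl | rfl <;>
  · simp only [hW, hT, LinearMap.add_apply, LinearMap.sub_apply, LinearMap.smul_apply, Module.End.mul_apply,
      map_add, map_sub, map_smul, haa, hxx, h00, h11, h0a, h0x, h1a, h1x]
    linear_combination (norm := module) (hβ * (-1)) • v

theorem perA (a x b0 b1 Q : Matrix n n ℂ)
    (ha : a.IsHermitian) (hx : x.IsHermitian) (h0 : b0.IsHermitian) (h1 : b1.IsHermitian)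
    (hQ : Q.IsHermitian) (hQQ : Q * Q = Q)
    (haa : a * a = 1) (hxx : x * x = 1) (h00 : b0 * b0 = 1) (h11 : b1 * b1 = 1)
    (h0a : Commute b0 a) (h0x : Commute b0 x) (h1a : Commute b1 a) (h1x : Commute b1 x)
    (hQa : Commute Q a) (hQx : Commute Q x) (hQ0 : Commute Q b0) (hQ1 : Commute Q b1)
    (c k : ℝ) (ε : ℂ) (hε : ε = 1 ∨ ε = -1) (hk : k ^ 2 * (2 - c ^ 2) = 1) (hc : c ^ 2 ≠ 1)
    (ψ : n → ℂ) (q : ℂ) (hq : star ψ ⬝ᵥ Q *ᵥ ψ = q)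
    (hW : star ψ ⬝ᵥ (Q * (((2 * c * k : ℝ) : ℂ) • a + a * b0 + a * b1 + ε • (x * b0 - x * b1))) *ᵥ ψ
      = (4 * k : ℝ) * q) :
    (b0 + b1) *ᵥ Q *ᵥ ψ = (2 * k : ℂ) • a *ᵥ Q *ᵥ ψ ∧
    (b0 - b1) *ᵥ Q *ᵥ ψ = ε • ((2 * k : ℂ) • x *ᵥ (Q *ᵥ ψ - (c : ℂ) • a *ᵥ Q *ᵥ ψ)) := by
  obtain ⟨W, hWd⟩ : ∃ W, W = ((2 * c * k : ℝ) : ℂ) • a + a * b0 + a * b1 + ε • (x * b0 - x * b1) := ⟨_, rfl⟩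
  obtain ⟨T, hTd⟩ : ∃ T, T = ε • (((2 * c * k : ℝ) : ℂ) • x - x * b0 - x * b1) - (a * b0 - a * b1) := ⟨_, rfl⟩
  have mv : ∀ {M M' : Matrix n n ℂ}, Commute M M' → ∀ v, toLin' M (toLin' M' v) = toLin' M' (toLin' M v) := by
    intro M M' h v
    simp only [toLin'_apply, mulVec_mulVec, h.eq]
  have mv1 : ∀ {M : Matrix n n ℂ}, M * M = 1 → ∀ v, toLin' M (toLin' M v) = v := by
    intro M h v
    simp only [toLin'_apply, mulVec_mulVec, h, one_mulVec]
  have hεs : star ε = ε := by rcases hε with rfl | rfl <;> simp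
  have cm : ∀ {M M' : Matrix n n ℂ}, M.IsHermitian → M'.IsHermitian → Commute M' M → (M * M')ᴴ = M * M' := by
    intro M M' h h' hc
    rw [conjTranspose_mul, h.eq, h'.eq, hc.eq]
  have hWh : W.IsHermitian := by
    unfold Matrix.IsHermitian
    rw [hWd]
    simp only [conjTranspose_add, conjTranspose_sub, conjTranspose_smul, ha.eq, cm ha h0 h0a, cm ha h1 h1a, cm hx h0 h0x, cm hx h1 h1x, hεs]
    simp
  have hTh : T.IsHermitian := by
    unfold Matrix.IsHermitian
    rw [hTd]
    simp only [conjTranspose_add, conjTranspose_sub, conjTranspose_smul, hx.eq, cm ha h0 h0a, cm ha h1 h1a, cm hx h0 h0x, cm hx h1 h1x, hεs]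
    simp
  have hkC : (k : ℂ) ^ 2 * (2 - (c:ℂ) ^ 2) = 1 := by exact_mod_cast hk
  have hsos : W * W + T * T = (((4 * k : ℝ) : ℂ) ^ 2) • 1 := by
    apply (toLin' (R := ℂ)).injective
    refine LinearMap.ext fun v => ?_
    have := sosid (toLin' a) (toLin' x) (toLin' b0) (toLin' b1) (mv1 haa) (mv1 hxx) (mv1 h00) (mv1 h11)
      (mv h0a) (mv h0x) (mv h1a) (mv h1x) ((2 * c * k : ℝ) : ℂ) ((4 * k : ℝ) : ℂ) ε hε
      (by push_cast; linear_combination 8 * hkC) (toLin' W) (toLin' T)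
      (by rw [hWd]; simp [toLin'_mul, Module.End.mul_eq_comp]) (by rw [hTd]; simp [toLin'_mul, Module.End.mul_eq_comp])
    simpa [toLin'_mul] using this v
  have hQW : Commute Q W := by
    rw [hWd]
    exact ((((hQa.smul_right _).add_right (hQa.mul_right hQ0)).add_right (hQa.mul_right hQ1)).add_right
      (((hQx.mul_right hQ0).sub_right (hQx.mul_right hQ1)).smul_right _))
  rw [← hWd] at hW
  have key : star (Q *ᵥ ψ) ⬝ᵥ W *ᵥ (Q *ᵥ ψ) = (4 * k : ℝ) * (star (Q *ᵥ ψ) ⬝ᵥ (Q *ᵥ ψ)) := by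
    rw [adjH Q hQ, adjH Q hQ, mulVec_mulVec, mulVec_mulVec, mulVec_mulVec, hQQ, hq, mul_assoc, ← hQW.eq, ← mul_assoc, hQQ, hW]
  obtain ⟨r1, r2⟩ := sos W T hWh hTh (4 * k) hsos _ key
  have := core1 (toLin' a) (toLin' x) (toLin' (b0 + b1)) (toLin' (b0 - b1)) (mv1 haa) (mv1 hxx)
    (mv (h0a.add_left h1a)) (mv (h0x.add_left h1x)) (mv (h0a.sub_left h1a)) (mv (h0x.sub_left h1x))
    (by intro v; rw [← LinearMap.comp_apply, ← LinearMap.comp_apply, ← toLin'_mul, ← toLin'_mul, ← LinearMap.neg_apply, ← map_neg]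
        congr 2; simp only [mul_add, sub_mul, add_mul, mul_sub, h00, h11]; abel)
    (by intro v; rw [← LinearMap.comp_apply, ← LinearMap.comp_apply, ← toLin'_mul, ← toLin'_mul]
        have : (b0 - b1) * (b0 - b1) = (4 : ℂ) • 1 - (b0 + b1) * (b0 + b1) := by
          simp only [mul_add, sub_mul, add_mul, mul_sub, h00, h11]; module
        rw [this]; simp)
    c k ε (by rcases hε with rfl | rfl <;> norm_num) hkC (by exact_mod_cast hc) (Q *ᵥ ψ)
    (by 
      rw [hWd] at r1
      simp only [add_mulVec, sub_mulVec, smul_mulVec, ← mulVec_mulVec] at r1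
      simp only [toLin'_apply, add_mulVec, sub_mulVec, mulVec_add, mulVec_sub]
      push_cast at r1
      linear_combination (norm := module) r1)
    (by 
      rw [hTd] at r2
      simp only [add_mulVec, sub_mulVec, smul_mulVec, ← mulVec_mulVec] at r2
      simp only [toLin'_apply, add_mulVec, sub_mulVec, mulVec_add, mulVec_sub]
      push_cast at r2
      linear_combination (norm := module) r2)
  simpa only [toLin'_apply] using this

end proj

/-- Lemma 1: self-testing of the tilted GHZ state
`cos θ |0…0⟩ + sin θ |1…1⟩`. -/
theorem stmt_2 (N : ℕ) (hN : 3 ≤ N) (θ α : ℝ) (hθ : θ ∈ Set.Ioc 0 (Real.pi / 4))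
    (hα : α = 2 * Real.cos (2 * θ) / Real.sqrt (1 + Real.sin (2 * θ) ^ 2))
    (d : Fin N → ℕ)
    (ψ : ((i : Fin N) → Fin (d i)) → ℂ) (hψ : star ψ ⬝ᵥ ψ = 1)
    (A : Fin 2 → (i : Fin N) → Matrix (Fin (d i)) (Fin (d i)) ℂ)
    (hAherm : ∀ a i, (A a i).IsHermitian) (hAunit : ∀ a i, A a i * A a i = 1)
    (h1 : ∀ i j : Fin N, (i : ℕ) < N - 1 → (j : ℕ) < N - 1 →
      star ψ ⬝ᵥ (siteOp i (projP 0 (A 0 i))).mulVec ψ = ((Real.cos θ) ^ 2 : ℂ) ∧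
      star ψ ⬝ᵥ
          ((siteOp i (projP 0 (A 0 i)) * siteOp j (projP 0 (A 0 j)))).mulVec ψ =
        ((Real.cos θ) ^ 2 : ℂ))
    (h2 : ∀ a : Fin N → Fin 2,
      star ψ ⬝ᵥ
          (multiOp (Finset.univ.filter fun i : Fin N => (i : ℕ) < N - 2)
            (fun i => projP (a i) (A 1 i))).mulVec ψ =
        ((2 : ℂ) ^ (N - 2))⁻¹)
    (h3 : ∀ a : Fin N → Fin 2,
      star ψ ⬝ᵥ
          ((multiOp (Finset.univ.filter fun i : Fin N => (i : ℕ) < N - 2)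
              (fun i => projP (a i) (A 1 i)) *
            tiltedW (by omega) α A
              ((-1 : ℂ) ^
                (∑ i ∈ Finset.univ.filter (fun i : Fin N => (i : ℕ) < N - 2),
                  (a i).val)))).mulVec ψ =
        (Real.sqrt (8 + 2 * α ^ 2) : ℂ) * ((2 : ℂ) ^ (N - 2))⁻¹) :
    ∃ V : (i : Fin N) → Matrix (Fin (d i) × Fin 2) (Fin (d i)) ℂ,
      (∀ i, (V i)ᴴ * V i = 1) ∧
      ∃ junk : ((i : Fin N) → Fin (d i)) → ℂ,
        star junk ⬝ᵥ junk = 1 ∧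
        tensorApply V ψ = fun p => junk p.1 * ghzVec N θ (fun _ => 0) p.2 := by

  classical
  obtain ⟨hθ0, hθ1⟩ := hθ
  have hpi := Real.pi_pos
  obtain ⟨c, hcd⟩ : ∃ c, c = Real.cos (2 * θ) := ⟨_, rfl⟩
  obtain ⟨s, hsd⟩ : ∃ s, s = Real.sin (2 * θ) := ⟨_, rfl⟩
  have hs0 : 0 < s := by
    rw [hsd]; exact Real.sin_pos_of_pos_of_lt_pi (by linarith) (by linarith)
  have hcs : s ^ 2 + c ^ 2 = 1 := by rw [hsd, hcd]; exact Real.sin_sq_add_cos_sq _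
  have hcos : 0 < Real.cos θ := Real.cos_pos_of_mem_Ioo ⟨by linarith, by linarith⟩
  have htan : (1 - c) / s * Real.cos θ = Real.sin θ := by
    have : s ≠ 0 := hs0.ne'
    field_simp
    rw [hcd, hsd, Real.cos_two_mul, Real.sin_two_mul]
    have := Real.sin_sq_add_cos_sq θ
    linear_combination -2 * Real.cos θ * this
  obtain ⟨k, hkd⟩ : ∃ k, k = (Real.sqrt (1 + s ^ 2))⁻¹ := ⟨_, rfl⟩
  have hk0 : 0 < k := by rw [hkd]; positivity
  have hk : k ^ 2 * (2 - c ^ 2) = 1 := by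
    rw [hkd, inv_pow, Real.sq_sqrt (by positivity)]
    have : 2 - c ^ 2 = 1 + s ^ 2 := by linarith
    rw [this]
    exact inv_mul_cancel₀ (by positivity)
  have hc1 : c ^ 2 ≠ 1 := by
    intro h; have : 0 < s ^ 2 := by positivity
    linarith
  have hα' : α = 2 * c * k := by rw [hα, ← hcd, ← hsd, hkd]; rfl
  have hβ : Real.sqrt (8 + 2 * α ^ 2) = 4 * k := by
    have : 8 + 2 * α ^ 2 = (4 * k) ^ 2 := by rw [hα']; linear_combination -8 * hk
    rw [this, Real.sqrt_sq (by positivity)]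
  clear hα hkd
  obtain ⟨S, hS⟩ : ∃ S, S = (Finset.univ.filter fun i : Fin N => (i : ℕ) < N - 2) := ⟨_, rfl⟩
  obtain ⟨m, hm⟩ : ∃ m : Fin N, m = ⟨N - 2, by omega⟩ := ⟨_, rfl⟩
  obtain ⟨l, hl⟩ : ∃ l : Fin N, l = ⟨N - 1, by omega⟩ := ⟨_, rfl⟩
  have hml : m ≠ l := by rw [hm, hl]; intro h; have := congrArg Fin.val h; simp at this; omega
  have hmS : m ∉ S := by rw [hS, hm]; simp
  have hlS : l ∉ S := by rw [hS, hl]; simp; omega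
  have hcov : ∀ i : Fin N, i ≠ l → i ≠ m → i ∈ S := by
    intro i h h'
    rw [hS]; simp
    have e1 : (i : ℕ) ≠ N - 1 := fun e => h (by rw [hl]; exact Fin.ext e)
    have e2 : (i : ℕ) ≠ N - 2 := fun e => h' (by rw [hm]; exact Fin.ext e)
    have := i.2
    omega
  have hlt : ∀ i : Fin N, i ≠ l → (i : ℕ) < N - 1 := by
    intro i h
    have e1 : (i : ℕ) ≠ N - 1 := fun e => h (by rw [hl]; exact Fin.ext e)
    have := i.2
    omega
  unfold tiltedW at h3
  rw [← hS] at h2 h3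
  rw [← hm, ← hl] at h3
  obtain ⟨a, had⟩ : ∃ a, a = siteOp m (A 0 m) := ⟨_, rfl⟩
  obtain ⟨x1, hx1d⟩ : ∃ a, a = siteOp m (A 1 m) := ⟨_, rfl⟩
  obtain ⟨b0, hb0d⟩ : ∃ a, a = siteOp l (A 0 l) := ⟨_, rfl⟩
  obtain ⟨b1, hb1d⟩ : ∃ a, a = siteOp l (A 1 l) := ⟨_, rfl⟩
  obtain ⟨Y, hYd⟩ : ∃ Y, Y = multiOp S (A 1) := ⟨_, rfl⟩
  have haa : a * a = 1 := by rw [had, ← siteOp_mul, hAunit, siteOp_one]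
  have hx1x1 : x1 * x1 = 1 := by rw [hx1d, ← siteOp_mul, hAunit, siteOp_one]
  have h00 : b0 * b0 = 1 := by rw [hb0d, ← siteOp_mul, hAunit, siteOp_one]
  have h11 : b1 * b1 = 1 := by rw [hb1d, ← siteOp_mul, hAunit, siteOp_one]
  have hYY : Y * Y = 1 := by
    rw [hYd, multiOp_mul, show A 1 * A 1 = 1 from funext fun i => hAunit 1 i, multiOp_one]
  have h0a : Commute b0 a := by rw [hb0d, had]; exact siteOp_comm hml.symm _ _
  have h1a : Commute b1 a := by rw [hb1d, had]; exact siteOp_comm hml.symm _ _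
  have h0x1 : Commute b0 x1 := by rw [hb0d, hx1d]; exact siteOp_comm hml.symm _ _
  have h1x1 : Commute b1 x1 := by rw [hb1d, hx1d]; exact siteOp_comm hml.symm _ _
  have hYa : Commute Y a := by rw [hYd, had]; exact multiOp_siteOp_comm hmS _ _
  have hYx1 : Commute Y x1 := by rw [hYd, hx1d]; exact multiOp_siteOp_comm hmS _ _
  have hYl : ∀ M, Commute Y (siteOp l M) := by intro M; rw [hYd]; exact multiOp_siteOp_comm hlS _ _
  obtain ⟨x, hxd⟩ : ∃ x, x = Y * x1 := ⟨_, rfl⟩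
  have hxx : x * x = 1 := by
    rw [hxd, mul_assoc, ← mul_assoc x1, ← hYx1.eq, mul_assoc, hx1x1, mul_one, hYY]
  have hlx : ∀ M, Commute (siteOp l M) x := by
    intro M
    rw [hxd]
    refine (hYl M).symm.mul_right ?_
    rw [hx1d]; exact siteOp_comm hml.symm _ _
  have hla : ∀ M, Commute (siteOp l M) a := by
    intro M; rw [had]; exact siteOp_comm hml.symm _ _
  -- the relations on each conditional vector
  have hper : ∀ e : Fin N → Fin 2,
      (b0 + b1 - (2 * k : ℂ) • a) *ᵥ (multiOp S (fun i => projP (e i) (A 1 i)) *ᵥ ψ) = 0 ∧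
      (b0 - b1 - (2 * k : ℂ) • (x * (1 - (c : ℂ) • a))) *ᵥ
        (multiOp S (fun i => projP (e i) (A 1 i)) *ᵥ ψ) = 0 := by
    intro e
    obtain ⟨Q, hQd⟩ : ∃ Q, Q = multiOp S (fun i => projP (e i) (A 1 i)) := ⟨_, rfl⟩
    obtain ⟨ε, hεd⟩ : ∃ ε : ℂ, ε = (-1 : ℂ) ^ (∑ i ∈ S, (e i).val) := ⟨_, rfl⟩
    have hQQ : Q * Q = Q := by
      rw [hQd, multiOp_mul]; congr 1; funext i; exact projP_idem _ _ (hAunit 1 i)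
    have hYQ : Y * Q = ε • Q := by
      rw [hYd, hQd, multiOp_mul, hεd, ← Finset.prod_pow_eq_pow_sum, ← multiOp_smul]
      congr 1; funext i; exact projP_mul _ _ (hAunit 1 i)
    have h2e := h2 e
    have h3e := h3 e
    rw [← hQd] at h2e h3e ⊢
    rw [← hεd, ← had, ← hx1d, ← hb0d, ← hb1d, hβ, hα'] at h3e
    have hε : ε = 1 ∨ ε = -1 := by rw [hεd]; exact neg_one_pow_eq_or _ _
    obtain ⟨q1, q2⟩ := perA a x1 b0 b1 Q (by rw [had]; exact siteOp_herm _ _ (hAherm _ _))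
      (by rw [hx1d]; exact siteOp_herm _ _ (hAherm _ _))
      (by rw [hb0d]; exact siteOp_herm _ _ (hAherm _ _))
      (by rw [hb1d]; exact siteOp_herm _ _ (hAherm _ _))
      (by rw [hQd]; exact multiOp_herm _ _ fun i => projP_herm _ _ (hAherm _ _))
      hQQ haa hx1x1 h00 h11 h0a h0x1 h1a h1x1
      (by rw [hQd, had]; exact multiOp_siteOp_comm hmS _ _)
      (by rw [hQd, hx1d]; exact multiOp_siteOp_comm hmS _ _)
      (by rw [hQd, hb0d]; exact multiOp_siteOp_comm hlS _ _)
      (by rw [hQd, hb1d]; exact multiOp_siteOp_comm hlS _ _)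
      c k ε hε hk hc1 ψ _ h2e h3e
    constructor
    · rw [sub_mulVec, q1, smul_mulVec, sub_self]
    · have e1 : x * (1 - (c : ℂ) • a) * Q = ε • (x1 * (1 - (c : ℂ) • a) * Q) := by
        have hYK : Commute Y (x1 * (1 - (c : ℂ) • a)) :=
          hYx1.mul_right ((Commute.one_right _).sub_right (hYa.smul_right _))
        rw [hxd, mul_assoc Y, hYK.eq, mul_assoc _ Y, hYQ, mul_smul_comm]
      have e2 : (x * (1 - (c : ℂ) • a)) *ᵥ Q *ᵥ ψ = ε • x1 *ᵥ (Q *ᵥ ψ - (c : ℂ) • a *ᵥ Q *ᵥ ψ) := by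
        rw [mulVec_mulVec, e1, smul_mulVec, ← mulVec_mulVec, ← mulVec_mulVec, sub_mulVec, one_mulVec, smul_mulVec]
      rw [sub_mulVec, q2, smul_mulVec, e2, sub_eq_zero, smul_comm]
  obtain ⟨C, hC0, hC⟩ := multiOp_sum S (fun b i => projP b (A 1 i)) (fun i => projP_sum _)
  have hsum : ∀ M : Matrix ((j : Fin N) → Fin (d j)) ((j : Fin N) → Fin (d j)) ℂ,
      (∀ e : Fin N → Fin 2, M *ᵥ (multiOp S (fun i => projP (e i) (A 1 i)) *ᵥ ψ) = 0) → M *ᵥ ψ = 0 := by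
    intro M hM
    have : M *ᵥ ((∑ e : Fin N → Fin 2, multiOp S (fun i => projP (e i) (A 1 i))) *ᵥ ψ) = 0 := by
      rw [Matrix.sum_mulVec, Matrix.mulVec_sum]
      exact Finset.sum_eq_zero fun e _ => hM e
    rw [hC, smul_mulVec, one_mulVec, mulVec_smul] at this
    exact (smul_eq_zero.1 this).resolve_left hC0
  have E1 := hsum _ fun e => (hper e).1
  have E2 := hsum _ fun e => (hper e).2
  rw [sub_mulVec, sub_eq_zero, smul_mulVec] at E1 E2
  rw [← mulVec_mulVec, sub_mulVec 1, one_mulVec, smul_mulVec] at E2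
  have mv : ∀ {M M' : Matrix ((j : Fin N) → Fin (d j)) ((j : Fin N) → Fin (d j)) ℂ}, Commute M M' → ∀ v, toLin' M (toLin' M' v) = toLin' M' (toLin' M v) := by
    intro M M' h v
    simp only [toLin'_apply, mulVec_mulVec, h.eq]
  have mv1 : ∀ {M : Matrix ((j : Fin N) → Fin (d j)) ((j : Fin N) → Fin (d j)) ℂ}, M * M = 1 → ∀ v, toLin' M (toLin' M v) = v := by
    intro M h v
    simp only [toLin'_apply, mulVec_mulVec, h, one_mulVec]
  have h0x : Commute b0 x := by rw [hb0d]; exact hlx _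
  have h1x : Commute b1 x := by rw [hb1d]; exact hlx _
  obtain ⟨f1, f2, -, f4, f5⟩ := core2 (toLin' a) (toLin' x) (toLin' (b0 + b1)) (toLin' (b0 - b1)) (mv1 haa) (mv1 hxx)
    (mv (h0a.add_left h1a)) (mv (h0x.add_left h1x)) (mv (h0a.sub_left h1a))
    (by intro v; rw [← LinearMap.comp_apply, ← LinearMap.comp_apply, ← toLin'_mul, ← toLin'_mul, ← LinearMap.neg_apply, ← map_neg]
        congr 2; simp only [mul_add, sub_mul, add_mul, mul_sub, h00, h11]; abel)
    (by intro v; rw [← LinearMap.comp_apply, ← LinearMap.comp_apply, ← toLin'_mul, ← toLin'_mul]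
        have : (b0 - b1) * (b0 - b1) = (4 : ℂ) • 1 - (b0 + b1) * (b0 + b1) := by
          simp only [mul_add, sub_mul, add_mul, mul_sub, h00, h11]; module
        rw [this]; simp)
    (c : ℂ) (s : ℂ) (k : ℂ) (by exact_mod_cast hk) (by exact_mod_cast hc1) (by exact_mod_cast hcs) ψ
    E1 E2
  simp only [toLin'_apply] at f1 f2 f4 f5
  -- regularised operators at the last site
  obtain ⟨CZ, hCZ⟩ : ∃ M, M = ((2 * k : ℂ))⁻¹ • (A 0 l + A 1 l) := ⟨_, rfl⟩
  obtain ⟨CX, hCX⟩ : ∃ M, M = ((2 * k * s : ℂ))⁻¹ • (A 0 l - A 1 l) := ⟨_, rfl⟩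
  have sCZ : siteOp l CZ = ((2 * k : ℂ))⁻¹ • (b0 + b1) := by
    rw [hCZ, siteOp_smul, siteOp_add, hb0d, hb1d]
  have sCX : siteOp l CX = ((2 * k * s : ℂ))⁻¹ • (b0 - b1) := by
    rw [hCX, siteOp_smul, siteOp_sub, hb0d, hb1d]
  simp only [← smul_mulVec] at f1 f2 f4 f5
  rw [← sCZ] at f1 f2
  rw [← sCX] at f4 f5
  obtain ⟨Zh, GZ, hZh, hZZ, hZe⟩ := signLemma CZ (by
    rw [hCZ]; unfold Matrix.IsHermitian
    rw [conjTranspose_smul, conjTranspose_add, (hAherm 0 l).eq, (hAherm 1 l).eq]; simp)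
  obtain ⟨Xh, GX, hXh, hXX, hXe⟩ := signLemma CX (by
    rw [hCX]; unfold Matrix.IsHermitian
    rw [conjTranspose_smul, conjTranspose_sub, (hAherm 0 l).eq, (hAherm 1 l).eq]; simp)
  have gZ : siteOp l Zh *ᵥ ψ = a *ᵥ ψ := by
    rw [hZe, siteOp_add, siteOp_mul, siteOp_sub, siteOp_mul, siteOp_one, add_mulVec, ← mulVec_mulVec,
      sub_mulVec, ← mulVec_mulVec, f2, one_mulVec, sub_self, mulVec_zero, add_zero, f1]
  have gX : siteOp l Xh *ᵥ ψ = siteOp l CX *ᵥ ψ := by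
    rw [hXe, siteOp_add, siteOp_mul, siteOp_sub, siteOp_mul, siteOp_one, add_mulVec, ← mulVec_mulVec,
      sub_mulVec, ← mulVec_mulVec, f4, one_mulVec, sub_self, mulVec_zero, add_zero]
  rw [← gX] at f5
  obtain ⟨Zf, hZf⟩ : ∃ Zf, Zf = Function.update (A 0) l Zh := ⟨_, rfl⟩
  obtain ⟨Xf, hXf⟩ : ∃ Xf, Xf = Function.update (A 1) l Xh := ⟨_, rfl⟩
  have hZfh : ∀ i, (Zf i).IsHermitian := by
    intro i
    by_cases h : i = l
    · subst h; rw [hZf, Function.update_self]; exact hZh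
    · rw [hZf, Function.update_of_ne h]; exact hAherm 0 i
  have hZfu : ∀ i, Zf i * Zf i = 1 := by
    intro i
    by_cases h : i = l
    · subst h; rw [hZf, Function.update_self]; exact hZZ
    · rw [hZf, Function.update_of_ne h]; exact hAunit 0 i
  have hXfh : ∀ i, (Xf i).IsHermitian := by
    intro i
    by_cases h : i = l
    · subst h; rw [hXf, Function.update_self]; exact hXh
    · rw [hXf, Function.update_of_ne h]; exact hAherm 1 i
  have hXfu : ∀ i, Xf i * Xf i = 1 := by
    intro i
    by_cases h : i = l
    · subst h; rw [hXf, Function.update_self]; exact hXX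
    · rw [hXf, Function.update_of_ne h]; exact hAunit 1 i
  have sproj : ∀ (b : Fin 2) (i : Fin N) (D : Matrix (Fin (d i)) (Fin (d i)) ℂ),
      siteOp i (projP b D) *ᵥ ψ = (2⁻¹ : ℂ) • (ψ + ((-1 : ℂ) ^ b.val) • siteOp i D *ᵥ ψ) := by
    intro b i D
    rw [projP, siteOp_smul, siteOp_add, siteOp_one, siteOp_smul, smul_mulVec, add_mulVec, one_mulVec, smul_mulVec]
  have hPm : ∀ i, i ≠ l → siteOp i (projP 0 (A 0 i)) *ᵥ ψ = siteOp m (projP 0 (A 0 m)) *ᵥ ψ := by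
    intro i hi
    exact proj_eq _ _ (siteOp_herm _ _ (projP_herm _ _ (hAherm _ _))) (siteOp_herm _ _ (projP_herm _ _ (hAherm _ _)))
      (by rw [← siteOp_mul, projP_idem _ _ (hAunit 0 i)]) (by rw [← siteOp_mul, projP_idem _ _ (hAunit 0 m)])
      ψ _ (h1 i i (hlt i hi) (hlt i hi)).1 (h1 m m (hlt m hml) (hlt m hml)).1
      (h1 i m (hlt i hi) (hlt m hml)).2 (h1 m i (hlt m hml) (hlt i hi)).2
  have hZψ : ∀ i, siteOp i (Zf i) *ᵥ ψ = a *ᵥ ψ := by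
    intro i
    by_cases h : i = l
    · subst h; rw [hZf, Function.update_self]; exact gZ
    · rw [hZf, Function.update_of_ne h]
      have := hPm i h
      rw [sproj, sproj, ← had] at this
      have := smul_right_injective _ (by norm_num : (2⁻¹ : ℂ) ≠ 0) this
      simpa using this
  have hPψ : ∀ (b : Fin 2) i, siteOp i (projP b (Zf i)) *ᵥ ψ = (2⁻¹ : ℂ) • (ψ + ((-1 : ℂ) ^ b.val) • a *ᵥ ψ) := by
    intro b i
    rw [sproj, hZψ]
  have hXtens : tens Xf = siteOp l Xh * x := by
    rw [hxd, hYd, hx1d, siteOp_eq, siteOp_eq, multiOp_eq, ← tens_mul, ← tens_mul]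
    congr 1
    funext i
    by_cases h : i = l
    · subst h; simp [hXf, hlS, hml.symm]
    · by_cases h' : i = m
      · subst h'; simp [hXf, h, hmS]
      · simp [hXf, h, h', hcov i h h']
  -- the isometries
  let W : Fin 2 → (i : Fin N) → Matrix (Fin (d i)) (Fin (d i)) ℂ := fun b i =>
    if b = 0 then projP 0 (Zf i) else Xf i * projP 1 (Zf i)
  refine ⟨fun i => Matrix.of fun p q => W p.2 i p.1 q, ?_, 
    ((Real.cos θ : ℂ))⁻¹ • ((2⁻¹ : ℂ) • (ψ + a *ᵥ ψ)), ?_, ?_⟩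
  · intro i
    have e1 : (W 0 i)ᴴ * W 0 i + (W 1 i)ᴴ * W 1 i = 1 := by
      simp only [W, if_true, one_ne_zero, if_false]
      rw [conjTranspose_mul, (hXfh i).eq, (projP_herm _ _ (hZfh i)).eq, (projP_herm _ _ (hZfh i)).eq,
        mul_assoc, ← mul_assoc (Xf i), hXfu, one_mul, projP_idem _ _ (hZfu i), projP_idem _ _ (hZfu i), projP_sum]
    rw [← e1]
    ext p q
    simp [Matrix.mul_apply, Fintype.sum_prod_type, Finset.sum_add_distrib]
  · have e1 : siteOp m (projP 0 (A 0 m)) *ᵥ ψ = (2⁻¹ : ℂ) • (ψ + a *ᵥ ψ) := by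
      rw [sproj, ← had]; simp
    rw [← e1, star_smul, smul_dotProduct, dotProduct_smul, adjH _ (siteOp_herm _ _ (projP_herm _ _ (hAherm _ _))),
      mulVec_mulVec, ← siteOp_mul, projP_idem _ _ (hAunit 0 m), (h1 m m (hlt m hml) (hlt m hml)).1]
    have : (Real.cos θ : ℂ) ≠ 0 := by exact_mod_cast hcos.ne'
    rw [smul_eq_mul, smul_eq_mul, star_inv₀, Complex.star_def, Complex.conj_ofReal]
    field_simp
  · have hcC : (Real.cos θ : ℂ) ≠ 0 := by exact_mod_cast hcos.ne'
    have e0 : ∀ e : Fin N → Fin 2, tens (fun i => W (e i) i) *ᵥ ψ =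
        fun y => (((Real.cos θ : ℂ))⁻¹ • ((2⁻¹ : ℂ) • (ψ + a *ᵥ ψ))) y * ghzVec N θ (fun _ => 0) e := by
      intro e
      obtain ⟨P, hP⟩ : ∃ P : (i : Fin N) → Matrix (Fin (d i)) (Fin (d i)) ℂ, P = fun i => projP (e i) (Zf i) := ⟨_, rfl⟩
      have hfac : tens (fun i => W (e i) i) = tens (fun i => if e i = 0 then 1 else Xf i) * tens P := by
        rw [← tens_mul]
        congr 1
        funext i
        have : e i = 0 ∨ e i = 1 := by omega
        rcases this with h | h <;> simp [W, hP, h]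
      have hPi : ∀ i, siteOp i (P i) *ᵥ ψ = (2⁻¹ : ℂ) • (ψ + ((-1 : ℂ) ^ (e i).val) • a *ᵥ ψ) := by
        intro i; rw [hP]; exact hPψ _ i
      have hPid : ∀ i, P i * P i = P i := by intro i; rw [hP]; exact projP_idem _ _ (hZfu i)
      rw [hfac, ← mulVec_mulVec]
      by_cases c0 : e = fun _ => 0
      · rw [tens_const P hPid m ψ _ (fun i => by rw [hPi i, c0])]
        have : (fun i => if e i = 0 then (1 : Matrix (Fin (d i)) (Fin (d i)) ℂ) else Xf i) = 1 := by
          funext i; simp [c0]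
        rw [this, tens_one, one_mulVec]
        have hne : (fun _ : Fin N => (0 : Fin 2)) ≠ fun _ => 1 := fun h => by
          have := congrFun h m; simp at this
        funext y
        have hcC' := hcC
        rw [Complex.ofReal_cos] at hcC'
        simp [ghzVec, c0, hne]
        field_simp
      by_cases c1 : e = fun _ => 1
      · rw [tens_const P hPid m ψ _ (fun i => by rw [hPi i, c1])]
        have : (fun i => if e i = 0 then (1 : Matrix (Fin (d i)) (Fin (d i)) ℂ) else Xf i) = Xf := by
          funext i; simp [c1]
        rw [this, hXtens, ← mulVec_mulVec]
        have e2 : siteOp l Xh *ᵥ x *ᵥ ((2⁻¹ : ℂ) • (ψ + ((-1 : ℂ) ^ (1 : Fin 2).val) • a *ᵥ ψ)) =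
            ((1 - (c : ℂ)) / s) • ((2⁻¹ : ℂ) • (ψ + a *ᵥ ψ)) := by
          rw [← f5]
          have := (hlx Xh).eq
          rw [mulVec_mulVec, this, ← mulVec_mulVec]
          congr 1
          rw [mulVec_smul, mulVec_add, mulVec_smul, mulVec_mulVec, (hla Xh).eq, ← mulVec_mulVec]
          congr 1
          simp [sub_eq_add_neg]
        rw [e2]
        have hne : (fun _ : Fin N => (1 : Fin 2)) ≠ fun _ => 0 := fun h => by
          have := congrFun h m; simp at this
        have ht : ((1 - (c : ℂ)) / s) * (Real.cos θ : ℂ) = (Real.sin θ : ℂ) := by exact_mod_cast htan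
        funext y
        simp only [ghzVec, c1, hne, if_false, zero_add, sub_zero, if_true]
        rw [← ht]
        simp only [Pi.smul_apply, smul_eq_mul]
        field_simp
      · have hg : ghzVec N θ (fun _ => 0) e = 0 := by
          simp [ghzVec, c0, c1]
        obtain ⟨i, hi⟩ : ∃ i, e i = 0 := by
          by_contra! h
          exact c1 (funext fun i => by have := h i; omega)
        obtain ⟨j, hj⟩ : ∃ j, e j = 1 := by
          by_contra! h
          exact c0 (funext fun i => by have := h i; omega)
        have hij : i ≠ j := by rintro rfl; rw [hi] at hj; simp at hj
        have : tens P *ᵥ ψ = 0 := by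
          apply tens_mixed P i j hij
          have : siteOp i (P i) *ᵥ ψ = siteOp j (projP 0 (Zf j)) *ᵥ ψ := by
            rw [hPi, hPψ, hi]
          rw [this, mulVec_mulVec, ← siteOp_mul, hP]
          simp only [hj]
          rw [projP_orth' _ (hZfu j)]
          have : siteOp j (0 : Matrix (Fin (d j)) (Fin (d j)) ℂ) = 0 := by
            ext x y; simp [siteOp]
          rw [this, zero_mulVec]
        rw [this, mulVec_zero, hg]
        funext y; simp
    funext p
    exact congrFun (e0 p.2) p.1

end
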